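/- Every lightcone framed curve (γ,ℓ⁺,ℓ⁻) : I → ℝ³₁ × Δ₄ is an (n,n̄)-Bertrand lightcone framed curve: for any non-zero constant λ, the curve (γ̄,ℓ̄⁺,ℓ̄⁻) with γ̄(t) = γ(t) + λ·n(t), ℓ̄⁺(t) = ℓ⁺(t), ℓ̄⁻(t) = ℓ⁻(t) is a lightcone framed curve with lightcone curvature (κ₁, κ₂, κ₃, α + λκ₂, β + λκ₃), and the two curves are (n,n̄)-mates. -/

import Mathlib

open Matrix

noncomputable section

/-- The Minkowski pseudo-scalar product on `ℝ³`:
`⟨x,y⟩ = −x₁y₁ + x₂y₂ + x₃y₃`. -/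
def mdot (x y : Fin 3 → ℝ) : ℝ := -(x 0 * y 0) + x 1 * y 1 + x 2 * y 2

/-- The pseudo vector product `x ∧ y` on Minkowski `ℝ³`, i.e. the determinant of the
matrix with rows `(−e₁, e₂, e₃)`, `x`, `y`. -/
def mcross (x y : Fin 3 → ℝ) : Fin 3 → ℝ :=
  ![-(x 1 * y 2 - x 2 * y 1), x 2 * y 0 - x 0 * y 2, x 0 * y 1 - x 1 * y 0]

/-- The (punctured) lightcone `LC* = {x ≠ 0 : ⟨x,x⟩ = 0}`. -/
def LCstar (x : Fin 3 → ℝ) : Prop := x ≠ 0 ∧ mdot x x = 0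

/-- Membership in `Δ₄ = {(v,w) ∈ LC* × LC* : ⟨v,w⟩ = −2}`. -/
def MemDelta4 (v w : Fin 3 → ℝ) : Prop := LCstar v ∧ LCstar w ∧ mdot v w = -2

/-- `n(t) = −(1/2) ℓ⁺(t) ∧ ℓ⁻(t)`. -/
def lcn (lp lm : ℝ → Fin 3 → ℝ) : ℝ → Fin 3 → ℝ :=
  fun t => (-(1/2) : ℝ) • mcross (lp t) (lm t)

/-- Smoothness (on `I`) of a real valued function. -/
def Smooth1 (I : Set ℝ) (f : ℝ → ℝ) : Prop := ContDiffOn ℝ (⊤ : ℕ∞) f I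

/-- Smoothness (on `I`) of an `ℝ³`-valued function. -/
def Smooth3 (I : Set ℝ) (f : ℝ → Fin 3 → ℝ) : Prop := ContDiffOn ℝ (⊤ : ℕ∞) f I

/-- `λ ≢ 0` : the set where `λ` is non-zero is dense in `I`. -/
def NotIdentZero (I : Set ℝ) (f : ℝ → ℝ) : Prop :=
  I ⊆ closure {t | t ∈ I ∧ f t ≠ 0}

/-- A lightcone framed curve `(γ, ℓ⁺, ℓ⁻) : I → ℝ³₁ × Δ₄`. -/
structure IsLightconeFramedCurve (I : Set ℝ) (γ lp lm : ℝ → Fin 3 → ℝ) : Prop where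
  smooth_base : Smooth3 I γ
  smooth_lp : Smooth3 I lp
  smooth_lm : Smooth3 I lm
  delta4 : ∀ t ∈ I, MemDelta4 (lp t) (lm t)
  exists_coeffs : ∃ α β : ℝ → ℝ, Smooth1 I α ∧ Smooth1 I β ∧
    ∀ t ∈ I, deriv γ t = α t • lp t + β t • lm t

/-- `(κ₁, κ₂, κ₃, α, β)` is the lightcone curvature of the lightcone framed curve
`(γ, ℓ⁺, ℓ⁻)`. -/
structure HasLightconeCurvature (I : Set ℝ) (γ lp lm : ℝ → Fin 3 → ℝ)
    (κ₁ κ₂ κ₃ α β : ℝ → ℝ) : Prop where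
  smooth_κ₁ : Smooth1 I κ₁
  smooth_κ₂ : Smooth1 I κ₂
  smooth_κ₃ : Smooth1 I κ₃
  smooth_α : Smooth1 I α
  smooth_β : Smooth1 I β
  deriv_lp : ∀ t ∈ I, deriv lp t = κ₁ t • lp t + (2 * κ₃ t) • lcn lp lm t
  deriv_lm : ∀ t ∈ I, deriv lm t = (-κ₁ t) • lm t + (2 * κ₂ t) • lcn lp lm t
  deriv_n : ∀ t ∈ I, deriv (lcn lp lm) t = κ₂ t • lp t + κ₃ t • lm t
  deriv_base : ∀ t ∈ I, deriv γ t = α t • lp t + β t • lm t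

/-- The vector field `ℓ⁺` built from a lightcone frame. -/
def fieldLp (lp lm : ℝ → Fin 3 → ℝ) : ℝ → Fin 3 → ℝ := fun t => lp t
/-- The vector field `ℓ⁻` built from a lightcone frame. -/
def fieldLm (lp lm : ℝ → Fin 3 → ℝ) : ℝ → Fin 3 → ℝ := fun t => lm t
/-- `nᵀ = (ℓ⁺ + ℓ⁻)/2`. -/
def fieldNT (lp lm : ℝ → Fin 3 → ℝ) : ℝ → Fin 3 → ℝ := fun t => (1/2 : ℝ) • (lp t + lm t)
/-- `nˢ = (ℓ⁺ − ℓ⁻)/2`. -/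
def fieldNS (lp lm : ℝ → Fin 3 → ℝ) : ℝ → Fin 3 → ℝ := fun t => (1/2 : ℝ) • (lp t - lm t)
/-- `n = −(1/2) ℓ⁺ ∧ ℓ⁻`. -/
def fieldN (lp lm : ℝ → Fin 3 → ℝ) : ℝ → Fin 3 → ℝ := lcn lp lm
/-- `ℓ̃⁺ = nᵀ + n`. -/
def fieldLtp (lp lm : ℝ → Fin 3 → ℝ) : ℝ → Fin 3 → ℝ :=
  fun t => fieldNT lp lm t + fieldN lp lm t
/-- `ℓ̃⁻ = nᵀ − n`. -/
def fieldLtm (lp lm : ℝ → Fin 3 → ℝ) : ℝ → Fin 3 → ℝ :=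
  fun t => fieldNT lp lm t - fieldN lp lm t

/-- `(γ,ℓ⁺,ℓ⁻)` and `(γ̄,ℓ̄⁺,ℓ̄⁻)` are `(v,w̄)`-mates. -/
def AreMates (I : Set ℝ)
    (v w : (ℝ → Fin 3 → ℝ) → (ℝ → Fin 3 → ℝ) → ℝ → Fin 3 → ℝ)
    (γ lp lm γ' lp' lm' : ℝ → Fin 3 → ℝ) : Prop :=
  IsLightconeFramedCurve I γ lp lm ∧ IsLightconeFramedCurve I γ' lp' lm' ∧
  ∃ lam : ℝ → ℝ, Smooth1 I lam ∧ NotIdentZero I lam ∧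
    (∀ t ∈ I, γ' t = γ t + lam t • v lp lm t) ∧
    (∀ t ∈ I, v lp lm t = w lp' lm' t)

/-- `(γ,ℓ⁺,ℓ⁻)` is a `(v,w̄)`-Bertrand lightcone framed curve. -/
def IsBertrand (I : Set ℝ)
    (v w : (ℝ → Fin 3 → ℝ) → (ℝ → Fin 3 → ℝ) → ℝ → Fin 3 → ℝ)
    (γ lp lm : ℝ → Fin 3 → ℝ) : Prop :=
  ∃ γ' lp' lm' : ℝ → Fin 3 → ℝ, AreMates I v w γ lp lm γ' lp' lm'

theorem Smooth3.lcn {I : Set ℝ} {lp lm : ℝ → Fin 3 → ℝ} (hp : Smooth3 I lp)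
    (hm : Smooth3 I lm) : Smooth3 I (lcn lp lm) := by
  have hp' := contDiffOn_pi.1 hp
  have hm' := contDiffOn_pi.1 hm
  refine contDiffOn_pi.2 fun i => ?_
  have minor (j k : Fin 3) : ContDiffOn ℝ (⊤ : ℕ∞)
      (fun t => lp t j * lm t k - lp t k * lm t j) I :=
    ((hp' j).mul (hm' k)).sub ((hp' k).mul (hm' j))
  fin_cases i
  · exact contDiffOn_const.mul (minor 1 2).neg
  · refine contDiffOn_const.mul ((minor 2 0).congr fun t _ => ?_)
    simp [mcross]
  · exact contDiffOn_const.mul (minor 0 1)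

theorem deriv_add_const_smul_lcn {I : Set ℝ} (hIo : IsOpen I)
    {γ lp lm : ℝ → Fin 3 → ℝ} {κ₁ κ₂ κ₃ α β : ℝ → ℝ}
    (hF : IsLightconeFramedCurve I γ lp lm)
    (hC : HasLightconeCurvature I γ lp lm κ₁ κ₂ κ₃ α β) (c : ℝ) {t : ℝ} (ht : t ∈ I) :
    deriv (fun s => γ s + c • lcn lp lm s) t =
      (α t + c * κ₂ t) • lp t + (β t + c * κ₃ t) • lm t := by
  have hγ : DifferentiableAt ℝ γ t :=
    (hF.smooth_base.contDiffAt (hIo.mem_nhds ht)).differentiableAt (by simp)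
  have hn : DifferentiableAt ℝ (lcn lp lm) t :=
    ((hF.smooth_lp.lcn hF.smooth_lm).contDiffAt (hIo.mem_nhds ht)).differentiableAt (by simp)
  rw [(hγ.hasDerivAt.fun_add (hn.hasDerivAt.fun_const_smul c)).deriv, hC.deriv_base t ht,
    hC.deriv_n t ht]
  module

/-- Every lightcone framed curve is an `(n,n̄)`-Bertrand lightcone framed curve: the
parallel curve `γ̄ = γ + λ n` (with `λ` a non-zero constant) together with the same frame
is a lightcone framed curve with curvature `(κ₁,κ₂,κ₃,α+λκ₂,β+λκ₃)`, and the two curves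
are `(n,n̄)`-mates. -/
theorem bertrand_n_nbar
    (I : Set ℝ) (hIo : IsOpen I) (hIc : I.OrdConnected)
    (γ lp lm : ℝ → Fin 3 → ℝ) (κ₁ κ₂ κ₃ α β : ℝ → ℝ)
    (hF : IsLightconeFramedCurve I γ lp lm)
    (hC : HasLightconeCurvature I γ lp lm κ₁ κ₂ κ₃ α β)
    (c : ℝ) (hc : c ≠ 0) :
    IsBertrand I fieldN fieldN γ lp lm ∧
    IsLightconeFramedCurve I (fun t => γ t + c • lcn lp lm t) lp lm ∧
    HasLightconeCurvature I (fun t => γ t + c • lcn lp lm t) lp lm κ₁ κ₂ κ₃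
      (fun t => α t + c * κ₂ t) (fun t => β t + c * κ₃ t) ∧
    AreMates I fieldN fieldN γ lp lm (fun t => γ t + c • lcn lp lm t) lp lm := by
  have hα : Smooth1 I fun t => α t + c * κ₂ t :=
    hC.smooth_α.add (contDiffOn_const.mul hC.smooth_κ₂)
  have hβ : Smooth1 I fun t => β t + c * κ₃ t :=
    hC.smooth_β.add (contDiffOn_const.mul hC.smooth_κ₃)
  have hd := fun t (ht : t ∈ I) => deriv_add_const_smul_lcn hIo hF hC c ht
  have hcurve : IsLightconeFramedCurve I (fun t => γ t + c • lcn lp lm t) lp lm :=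
    { hF with
      smooth_base := hF.smooth_base.add
        ((hF.smooth_lp.lcn hF.smooth_lm).const_smul c)
      exists_coeffs := ⟨_, _, hα, hβ, hd⟩ }
  have hmates : AreMates I fieldN fieldN γ lp lm (fun t => γ t + c • lcn lp lm t) lp lm :=
    ⟨hF, hcurve, fun _ => c, contDiffOn_const, fun _ ht => subset_closure ⟨ht, hc⟩,
      fun _ _ => rfl, fun _ _ => rfl⟩
  exact ⟨⟨_, _, _, hmates⟩, hcurve,
    { hC with smooth_α := hα, smooth_β := hβ, deriv_base := hd }, hmates⟩
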